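/- Let α = (α_i)_{i≥0} be a complex weight that is regular with limit 1, suppose l₁,…,lₙ are not all equal, and fix 0 < ε < 1. Then lim_{k→∞} (#Ã_{k+S_𝔩,𝓜,ε}) / P(k,n) = 1. -/

import Mathlib

open Filter

/-- `⟨i⟩`: the multiset of coordinates of an integer tuple `i`. -/
def cls {n : ℕ} (i : Fin n → ℤ) : Multiset ℤ :=
  Multiset.map i Finset.univ.val

-- `𝓜`: the number of distinct rearrangements `l_π` of the tuple `l`.
open Classical in
noncomputable def Mcount {n : ℕ} (l : Fin n → ℤ) : ℕ :=
  (Finset.univ.image fun π : Equiv.Perm (Fin n) => l ∘ π).card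

/-- `R_i = {⟨j⟩ : j ∈ ℕⁿ, ∃ π ∈ Σₙ, ⟨j + l_π⟩ = ⟨i⟩}`. -/
def Rset {n : ℕ} (l : Fin n → ℤ) (i : Fin n → ℕ) : Set (Multiset ℤ) :=
  {m | ∃ j : Fin n → ℕ, m = cls (fun a => (j a : ℤ)) ∧
        ∃ π : Equiv.Perm (Fin n),
          cls (fun a => (j a : ℤ) + l (π a)) = cls (fun a => (i a : ℤ))}

/-- The weight extended to integer indices by `α_m = 0` for `m < 0`. -/
noncomputable def alphaE (α : ℕ → ℂ) (m : ℤ) : ℂ :=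
  if 0 ≤ m then α m.toNat else 0

/-- `Γ_{i,t}`: equal to `min{|α_i|,…,|α_{i+t−1}|}` if `t > 0`, to `1` if `t = 0`,
and to `min{|α_{i−1}|,…,|α_{i+t}|}` if `t < 0`. -/
noncomputable def Gamma (α : ℕ → ℂ) (i : ℕ) (t : ℤ) : ℝ :=
  if t = 0 then 1
  else sInf {x : ℝ | ∃ s : ℕ, s < t.natAbs ∧
    x = ‖alphaE α (if 0 < t then (i : ℤ) + s else (i : ℤ) - 1 - s)‖}

/-- `E_{r,m} = {⟨j⟩ : j ∈ ℕⁿ, |j| = r, #R_j = m}` (empty for `r < 0`). -/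
def Eset {n : ℕ} (l : Fin n → ℤ) (r : ℤ) (m : ℕ) : Set (Multiset ℤ) :=
  {c | ∃ j : Fin n → ℕ, c = cls (fun a => (j a : ℤ)) ∧
        (∑ a, (j a : ℤ)) = r ∧ Set.ncard (Rset l j) = m}

/-- `Ã_{k+S_𝔩,𝓜,ε}`: the classes `⟨j⟩` in `E_{k+S_𝔩,𝓜}` such that
`Γ_{j_m, −l_{π(m)}} > 1 − ε` for all `m` and all `π ∈ Σₙ`. -/
def Atilde {n : ℕ} (l : Fin n → ℤ) (α : ℕ → ℂ) (ε : ℝ) (k : ℤ) : Set (Multiset ℤ) :=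
  {c | ∃ j : Fin n → ℕ, c = cls (fun a => (j a : ℤ)) ∧
        (∑ a, (j a : ℤ)) = k + (∑ a, l a) ∧ Set.ncard (Rset l j) = Mcount l ∧
        ∀ (m : Fin n) (π : Equiv.Perm (Fin n)), 1 - ε < Gamma α (j m) (- l (π m))}


/-- `P(k,n)`: the number of partitions of `k` into at most `n` parts. -/
noncomputable def P (k n : ℕ) : ℕ :=
  Set.ncard {m : Multiset ℕ | Multiset.card m ≤ n ∧ (∀ x ∈ m, 0 < x) ∧ m.sum = k}

def Wset {n : ℕ} (w : Fin n → ℕ) (k : ℕ) : Finset (Fin n → ℕ) :=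
  (Fintype.piFinset fun _ => Finset.range (k + 1)).filter fun d => ∑ i, w i * d i = k

theorem mem_Wset {n : ℕ} (w : Fin n → ℕ) (hw : ∀ i, 0 < w i) (k : ℕ) (d : Fin n → ℕ) :
    d ∈ Wset w k ↔ ∑ i, w i * d i = k := by
  simp only [Wset, Finset.mem_filter, Fintype.mem_piFinset, Finset.mem_range,
    and_iff_right_iff_imp]
  intro h i
  have h1 : w i * d i ≤ ∑ i, w i * d i :=
    Finset.single_le_sum (f := fun i => w i * d i) (fun _ _ => Nat.zero_le _) (Finset.mem_univ i)
  have h2 : d i ≤ w i * d i := Nat.le_mul_of_pos_left _ (hw i)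
  omega

theorem bad_bound {n : ℕ} (hn : 0 < n) (w : Fin n → ℕ) (hw : ∀ i, 0 < w i) (C T : ℕ) (hT : 0 < T) :
    ∃ K, ∀ k ≥ K, ((Wset w k).filter fun d => ∃ i, d i < C).card * T
      ≤ (Wset w k).card * (n * (n * C)) := by
  refine ⟨∑ j, w j * (C + T * ∑ i, w i) + 1, fun k hk => ?_⟩
  have key : ∀ d : Fin n → ℕ, (d ∈ Wset w k ∧ ∃ i, d i < C) →
      ∃ p : Fin n × Fin n, d p.1 < C ∧ p.1 ≠ p.2 ∧ T * w p.1 ≤ d p.2 := by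
    rintro d ⟨hd, i, hi⟩
    rw [mem_Wset w hw] at hd
    by_contra! hcon
    have : ∑ j, w j * d j ≤ ∑ j, w j * (C + T * ∑ i, w i) := by
      refine Finset.sum_le_sum fun j _ => Nat.mul_le_mul_left _ ?_
      by_cases hij : i = j
      · subst hij; omega
      · have h1 := hcon (i, j) hi hij
        have h2 : w i ≤ ∑ i, w i :=
          Finset.single_le_sum (f := w) (fun _ _ => Nat.zero_le _) (Finset.mem_univ i)
        have h3 : T * w i ≤ T * ∑ i, w i := Nat.mul_le_mul_left _ h2
        simp only at h1
        omega
    omega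
  haveI : Nonempty (Fin n) := ⟨⟨0, hn⟩⟩
  choose! p hp1 hp2 hp3 using key
  rw [← Finset.card_range T, ← Finset.card_product]
  have : (Wset w k).card * (n * (n * C)) =
      ((Wset w k) ×ˢ ((Finset.univ : Finset (Fin n)) ×ˢ ((Finset.univ : Finset (Fin n)) ×ˢ
        (Finset.range C)))).card := by
    simp [Finset.card_product]
  rw [this]
  refine Finset.card_le_card_of_injOn (fun q =>
    (fun a => if a = (p q.1).1 then q.1 a + q.2 * w (p q.1).2 else
      if a = (p q.1).2 then q.1 a - q.2 * w (p q.1).1 else q.1 a,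
      (p q.1).1, (p q.1).2, q.1 (p q.1).1)) ?_ ?_
  · rintro ⟨d, t⟩ hq
    simp only [Finset.coe_product, Set.mem_prod, Finset.mem_coe, Finset.mem_filter,
      Finset.mem_range, Finset.card_range, Finset.mem_product, Finset.mem_univ, true_and] at hq ⊢
    obtain ⟨hd, ht⟩ := hq
    have h1 := hp1 d hd
    have h2 := hp2 d hd
    have h3 := hp3 d hd
    refine ⟨?_, h1⟩
    rw [mem_Wset w hw]
    have hd' := (mem_Wset w hw k d).1 hd.1
    rw [← hd']
    have htw : t * w (p d).1 ≤ d (p d).2 := le_trans (Nat.mul_le_mul_right _ ht.le) h3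
    zify
    rw [← sub_eq_zero, ← Finset.sum_sub_distrib,
      Finset.sum_eq_add (p d).1 (p d).2 h2]
    · simp only [if_true, h2.symm, if_false]
      push_cast [htw]
      ring
    · intro c _ hc
      simp [hc.1, hc.2]
    · simp
    · simp
  · rintro ⟨d, t⟩ hq ⟨d', t'⟩ hq' heq
    simp only [Finset.coe_product, Set.mem_prod, Finset.mem_coe, Finset.mem_filter,
      Finset.mem_range, Finset.card_range] at hq hq'
    simp only [Prod.mk.injEq] at heq
    obtain ⟨e0, e1, e2, e3⟩ := heq
    have hpp : p d = p d' := Prod.ext e1 e2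
    rw [← hpp] at e0 e3
    have h2 := hp2 d hq.1
    have h3 := hp3 d hq.1
    have h3' := hp3 d' hq'.1
    rw [← hpp] at h3'
    have ht : t = t' := by
      have := congrFun e0 (p d).1
      simp only [if_true, e3] at this
      exact Nat.eq_of_mul_eq_mul_right (hw _) (Nat.add_left_cancel this)
    subst ht
    have htw : t * w (p d).1 ≤ d (p d).2 := le_trans (Nat.mul_le_mul_right _ hq.2.le) h3
    have htw' : t * w (p d).1 ≤ d' (p d).2 := le_trans (Nat.mul_le_mul_right _ hq.2.le) h3'
    refine Prod.ext (funext fun a => ?_) rfl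
    have := congrFun e0 a
    simp only at this ⊢
    split_ifs at this with ha hb
    · omega
    · subst hb; omega
    · exact this

/-- partial sums -/
def psum {n : ℕ} (d : Fin n → ℕ) (a : Fin n) : ℕ := ∑ i ∈ Finset.Iic a, d i

def wt {n : ℕ} (i : Fin n) : ℕ := n - i

theorem wt_pos {n : ℕ} (i : Fin n) : 0 < wt i := by
  have := i.2; unfold wt; omega

theorem sum_psum {n : ℕ} (d : Fin n → ℕ) : ∑ a, psum d a = ∑ i, wt i * d i := by
  unfold psum
  rw [Finset.sum_comm' (t' := Finset.univ) (s' := fun i => Finset.Ici i) (by simp)]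
  refine Finset.sum_congr rfl fun i _ => ?_
  simp [wt]

theorem le_psum {n : ℕ} (d : Fin n → ℕ) (a : Fin n) : d a ≤ psum d a :=
  Finset.single_le_sum (f := d) (fun _ _ => Nat.zero_le _) (by simp)

theorem psum_lt {n : ℕ} (d : Fin n → ℕ) {a b : Fin n} (h : a < b) :
    psum d a + d b ≤ psum d b := by
  unfold psum
  have hn : b ∉ Finset.Iic a := by simpa using h
  have : ∑ i ∈ Finset.cons b (Finset.Iic a) hn, d i = d b + ∑ i ∈ Finset.Iic a, d i :=
    Finset.sum_cons hn
  rw [add_comm, ← this]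
  refine Finset.sum_le_sum_of_subset ?_
  intro i hi
  simp only [Finset.mem_cons, Finset.mem_Iic] at hi ⊢
  rcases hi with rfl | hi
  · exact le_rfl
  · exact hi.trans h.le

theorem psum_mono {n : ℕ} (d : Fin n → ℕ) : Monotone (psum d) := by
  intro a b h
  rcases h.lt_or_eq with h | rfl
  · have := psum_lt d h; omega
  · exact le_rfl

theorem psum_zero {n : ℕ} (d : Fin (n+1) → ℕ) : psum d 0 = d 0 := by
  unfold psum
  have : Finset.Iic (0 : Fin (n+1)) = {0} := by ext i; simp
  simp [this]

theorem psum_succ {n : ℕ} (d : Fin (n+1) → ℕ) (i : Fin n) :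
    psum d i.succ = psum d i.castSucc + d i.succ := by
  unfold psum
  have hn : i.succ ∉ Finset.Iic i.castSucc := by simp
  have : Finset.Iic i.succ = Finset.cons i.succ (Finset.Iic i.castSucc) hn := by
    ext j
    simp [Fin.le_def, Fin.ext_iff]
    omega
  rw [this, Finset.sum_cons, add_comm]

theorem psum_inj {n : ℕ} : Function.Injective (psum (n := n)) := by
  intro d d' h
  cases n with
  | zero => exact Subsingleton.elim _ _
  | succ n =>
    funext a
    refine Fin.cases ?_ (fun i => ?_) a
    · rw [← psum_zero d, ← psum_zero d', h]
    · have h1 := psum_succ d i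
      have h2 := psum_succ d' i
      rw [h] at h1
      omega

theorem psum_surj {n : ℕ} (x : Fin n → ℕ) (hx : Monotone x) : ∃ d, psum d = x := by
  cases n with
  | zero => exact ⟨x, Subsingleton.elim _ _⟩
  | succ n =>
    refine ⟨Fin.cases (x 0) (fun i => x i.succ - x i.castSucc), ?_⟩
    funext a
    induction a using Fin.induction with
    | zero => rw [psum_zero]; rfl
    | succ i ih =>
      rw [psum_succ, ih]
      have : x i.castSucc ≤ x i.succ := hx i.castSucc_le_succ
      simp only [Fin.cases_succ]
      omega

theorem cls_perm {n : ℕ} (f : Fin n → ℤ) (σ : Equiv.Perm (Fin n)) : cls (f ∘ σ) = cls f := by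
  unfold cls
  rw [← Multiset.map_map, ← Finset.map_univ_equiv σ]
  simp

theorem cls_mono_inj {n : ℕ} {f g : Fin n → ℤ} (hf : Monotone f) (hg : Monotone g)
    (h : cls f = cls g) : f = g := by
  have h1 : ∀ f : Fin n → ℤ, cls f = (List.ofFn f : Multiset ℤ) := by
    intro f
    unfold cls
    rw [Fin.univ_val_map]
  rw [h1, h1, Multiset.coe_eq_coe] at h
  apply List.ofFn_injective
  exact h.eq_of_pairwise' (List.sortedLE_ofFn_iff.2 hf).pairwise (List.sortedLE_ofFn_iff.2 hg).pairwise

theorem cls_eq {n : ℕ} {f g : Fin n → ℤ} (h : cls f = cls g) :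
    ∃ σ : Equiv.Perm (Fin n), f = g ∘ σ := by
  have h1 : f ∘ Tuple.sort f = g ∘ Tuple.sort g := by
    refine cls_mono_inj (Tuple.monotone_sort f) (Tuple.monotone_sort g) ?_
    rw [cls_perm, cls_perm, h]
  refine ⟨(Tuple.sort f).symm.trans (Tuple.sort g), ?_⟩
  funext a
  have := congrFun h1 ((Tuple.sort f).symm a)
  simpa using this

def clsN {n : ℕ} (i : Fin n → ℕ) : Multiset ℕ := Multiset.map i Finset.univ.val

theorem cls_clsN {n : ℕ} (i : Fin n → ℕ) : cls (fun a => (i a : ℤ)) = (clsN i).map (fun x : ℕ => (x : ℤ)) := by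
  unfold cls clsN
  rw [Multiset.map_map]
  rfl

theorem filt {m : Multiset ℕ} :
    m = m.filter (0 < ·) + Multiset.replicate (m.card - (m.filter (0 < ·)).card) 0 := by
  have h := Multiset.filter_add_not (fun x : ℕ => 0 < x) m
  have h2 : m.filter (fun x => ¬ 0 < x) = Multiset.replicate (m.filter (fun x => ¬ 0 < x)).card 0 := by
    rw [Multiset.eq_replicate]
    refine ⟨rfl, fun b hb => ?_⟩
    have := (Multiset.mem_filter.1 hb).2
    omega
  have h3 := congrArg Multiset.card h
  rw [Multiset.card_add] at h3
  have h4 : m.card - (m.filter (0 < ·)).card = (m.filter (fun x => ¬ 0 < x)).card := by omega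
  rw [h4, ← h2, h]

theorem exists_tuple {n : ℕ} (m : Multiset ℕ) (h : m.card = n) :
    ∃ f : Fin n → ℕ, Monotone f ∧ clsN f = m := by
  subst h
  have : ∃ f : Fin m.card → ℕ, clsN f = m := by
    induction m using Quotient.inductionOn with
    | h L =>
      refine ⟨L.get, ?_⟩
      unfold clsN
      refine (Fin.univ_val_map L.get).trans ?_
      exact congrArg _ (List.ofFn_get L)
  obtain ⟨f, hf⟩ := this
  refine ⟨f ∘ Tuple.sort f, Tuple.monotone_sort f, ?_⟩
  refine Eq.trans ?_ hf
  unfold clsN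
  rw [← Multiset.map_map]
  conv_rhs => rw [← Finset.map_univ_equiv (Tuple.sort f)]
  simp

theorem P_eq (k n : ℕ) : P k n = (Wset (n := n) wt k).card := by
  unfold P
  have : {m : Multiset ℕ | Multiset.card m ≤ n ∧ (∀ x ∈ m, 0 < x) ∧ m.sum = k}
      = (fun d : Fin n → ℕ => (clsN (psum d)).filter (0 < ·)) '' (Wset (n := n) wt k) := by
    have hs : ∀ m : Multiset ℕ, (m.filter (0 < ·)).sum = m.sum := by
      intro m
      conv_rhs => rw [filt (m := m)]
      simp
    ext m
    simp only [Set.mem_ofPred_eq, Set.mem_image, Finset.mem_coe, mem_Wset _ wt_pos]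
    constructor
    · rintro ⟨h1, h2, h3⟩
      obtain ⟨f, hf, hfm⟩ := exists_tuple (n := n) (m + Multiset.replicate (n - m.card) 0) (by simp; omega)
      obtain ⟨d, rfl⟩ := psum_surj f hf
      refine ⟨d, ?_, ?_⟩
      · rw [← sum_psum]
        have : (clsN (psum d)).sum = k := by rw [hfm]; simp [h3]
        exact this
      · rw [hfm, Multiset.filter_add, Multiset.filter_eq_self.2 h2]
        simp [Multiset.mem_replicate]
    · rintro ⟨d, hd, rfl⟩
      refine ⟨?_, ?_, ?_⟩
      · refine (Multiset.card_le_card (Multiset.filter_le _ _)).trans ?_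
        simp [clsN]
      · intro x hx
        exact (Multiset.mem_filter.1 hx).2
      · rw [hs, ← hd, ← sum_psum]; rfl
  rw [this, Set.ncard_image_of_injective, Set.ncard_coe_finset]
  intro d d' h
  simp only at h
  apply psum_inj
  have h1 : clsN (psum d) = clsN (psum d') := by
    rw [filt (m := clsN (psum d)), filt (m := clsN (psum d')), h]
    simp [clsN]
  have h2 := congrArg (Multiset.map (fun x : ℕ => (x : ℤ))) h1
  rw [← cls_clsN, ← cls_clsN] at h2
  have h3 := cls_mono_inj (fun a b hab => by exact_mod_cast psum_mono d hab)
    (fun a b hab => by exact_mod_cast psum_mono d' hab) h2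
  funext a
  exact_mod_cast congrFun h3 a

theorem Gamma_neg (α : ℕ → ℂ) (j : ℕ) (t : ℤ) (h : 0 < Gamma α j (-t)) : 0 ≤ (j : ℤ) - t := by
  by_contra hc
  have ht : 0 < t := by omega
  unfold Gamma at h
  rw [if_neg (by omega)] at h
  refine absurd h (not_lt.2 ?_)
  have h0 : alphaE α ((j : ℤ) - t) = 0 := by
    unfold alphaE; rw [if_neg (by omega)]
  refine csInf_le ⟨0, ?_⟩ ⟨(t - 1).toNat, by omega, ?_⟩
  · rintro x ⟨s, _, rfl⟩
    exact norm_nonneg _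
  · rw [if_neg (by omega)]
    have : (j : ℤ) - 1 - ((t - 1).toNat : ℤ) = j - t := by omega
    rw [this, h0, norm_zero]

theorem Gamma_large (α : ℕ → ℂ) (j : ℕ) (t : ℤ) (N : ℕ) (c : ℝ) (hc : c ≤ 1)
    (hN : ∀ i ≥ N, c ≤ ‖α i‖) (hj : N + |t| ≤ j) : c ≤ Gamma α j t := by
  unfold Gamma
  by_cases h0 : t = 0
  · rw [if_pos h0]; exact hc
  · rw [if_neg h0]
    refine le_csInf ⟨_, 0, by omega, rfl⟩ ?_
    rintro x ⟨s, hs, rfl⟩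
    have hs' : (s : ℤ) < |t| := by rw [Int.abs_eq_natAbs]; exact_mod_cast hs
    have : (N : ℤ) ≤ (if 0 < t then (j : ℤ) + s else (j : ℤ) - 1 - s) := by split_ifs <;> omega
    unfold alphaE
    rw [if_pos (by omega)]
    exact hN _ (by omega)

theorem upper_sub {n : ℕ} (l : Fin n → ℤ) (α : ℕ → ℂ) (ε : ℝ) (hε1 : ε < 1) (k : ℕ) :
    ∃ F : (Fin n → ℕ) → Multiset ℤ, Atilde l α ε (k : ℤ) ⊆ F '' (Wset (n := n) wt k) := by
  set τ := Tuple.sort (fun a => - l a)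
  have hτ : Monotone ((fun a => - l a) ∘ τ) := Tuple.monotone_sort _
  have hsub : Atilde l α ε (k : ℤ) ⊆
      (fun d : Fin n → ℕ => cls (fun a => (psum d a : ℤ) + l (τ a))) '' (Wset (n := n) wt k) := by
    rintro c ⟨j, rfl, hs, -, hG⟩
    set s := Tuple.sort j
    have hsm : Monotone (j ∘ s) := Tuple.monotone_sort _
    have hnn : ∀ a, 0 ≤ (j (s a) : ℤ) - l (τ a) := by
      intro a
      have := hG (s a) (s.symm.trans τ)
      simp only [Equiv.trans_apply, Equiv.symm_apply_apply] at this
      exact Gamma_neg α _ _ (by linarith)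
    obtain ⟨d, hd⟩ := psum_surj (fun a => ((j (s a) : ℤ) - l (τ a)).toNat) (by
      intro a b hab
      have h1 := hsm hab
      have h2 := hτ hab
      simp only [Function.comp] at h1 h2 ⊢
      omega)
    have hd' : ∀ a, (psum d a : ℤ) = (j (s a) : ℤ) - l (τ a) := by
      intro a; rw [hd]; exact Int.toNat_of_nonneg (hnn a)
    refine ⟨d, ?_, ?_⟩
    · rw [Finset.mem_coe, mem_Wset _ wt_pos, ← sum_psum]
      zify
      simp only [hd']
      rw [Finset.sum_sub_distrib, Equiv.sum_comp s (fun a => (j a : ℤ)), Equiv.sum_comp τ l, hs]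
      ring
    · simp only [hd', sub_add_cancel]
      exact cls_perm (fun a => (j a : ℤ)) s
  exact ⟨_, hsub⟩

theorem upper {n : ℕ} (l : Fin n → ℤ) (α : ℕ → ℂ) (ε : ℝ) (hε1 : ε < 1) (k : ℕ) :
    Set.ncard (Atilde l α ε (k : ℤ)) ≤ (Wset (n := n) wt k).card := by
  obtain ⟨F, hsub⟩ := upper_sub l α ε hε1 k
  calc _ ≤ _ := Set.ncard_le_ncard hsub ((Finset.finite_toSet _).image _)
    _ ≤ _ := Set.ncard_image_le (Finset.finite_toSet _)
    _ = _ := Set.ncard_coe_finset _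

theorem Rset_card {n : ℕ} (l : Fin n → ℤ) (L : ℤ) (hL : ∀ a, |l a| ≤ L) (j : Fin n → ℕ)
    (hj : ∀ a, L ≤ j a) (hgap : ∀ a b, a < b → (j a : ℤ) + 2 * L ≤ j b) :
    Set.ncard (Rset l j) = Mcount l := by
  classical
  have : Rset l j = (fun v : Fin n → ℤ => cls (fun a => (j a : ℤ) - v a)) ''
      ((Finset.univ.image fun π : Equiv.Perm (Fin n) => l ∘ π : Finset (Fin n → ℤ)) : Set (Fin n → ℤ)) := by
    ext m
    simp only [Rset, Set.mem_ofPred_eq, Set.mem_image, Finset.mem_coe, Finset.mem_image,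
      Finset.mem_univ, true_and]
    constructor
    · rintro ⟨i, rfl, π, h⟩
      obtain ⟨σ, hσ⟩ := cls_eq h
      refine ⟨l ∘ (σ.symm.trans π), ⟨_, rfl⟩, ?_⟩
      rw [← cls_perm (fun a => (i a : ℤ)) σ.symm]
      congr 1
      funext a
      have := congrFun hσ (σ.symm a)
      simp only [Function.comp, Equiv.apply_symm_apply, Equiv.trans_apply] at this ⊢
      omega
    · rintro ⟨_, ⟨π, rfl⟩, rfl⟩
      have hnn : ∀ a, (((j a : ℤ) - l (π a)).toNat : ℤ) = (j a : ℤ) - l (π a) := by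
        intro a
        have h1 := hL (π a)
        have h2 := hj a
        have h3 := le_abs_self (l (π a))
        omega
      refine ⟨fun a => ((j a : ℤ) - l (π a)).toNat, ?_, π, ?_⟩
      · simp only [hnn]; rfl
      · simp only [hnn, sub_add_cancel]
  rw [this, Set.ncard_image_of_injOn, Set.ncard_coe_finset]
  · unfold Mcount
    congr!
  · have hm : ∀ π : Equiv.Perm (Fin n), Monotone (fun a => (j a : ℤ) - (l ∘ π) a) := by
      intro π a b hab
      rcases hab.lt_or_eq with hab | rfl
      · have h1 := abs_le.1 (hL (π a))
        have h2 := abs_le.1 (hL (π b))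
        have h3 := hgap a b hab
        simp only [Function.comp]
        omega
      · exact le_rfl
    intro v hv v' hv' h
    simp only [Finset.coe_image, Finset.coe_univ, Set.image_univ, Set.mem_range] at hv hv'
    obtain ⟨π, rfl⟩ := hv
    obtain ⟨π', rfl⟩ := hv'
    have := cls_mono_inj (hm π) (hm π') h
    funext a
    have := congrFun this a
    omega

theorem lower {n : ℕ} (l : Fin n → ℤ) (α : ℕ → ℂ)
    (hlim : Tendsto (fun i => ‖α i‖) atTop (nhds 1)) (ε : ℝ) (hε0 : 0 < ε) (hε1 : ε < 1) :
    ∃ C : ℕ, ∀ k : ℕ, (Wset (n := n) wt k).card ≤ Set.ncard (Atilde l α ε (k : ℤ)) +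
      ((Wset (n := n) wt k).filter fun d => ∃ i, d i < C).card := by
  classical
  have hev : ∀ᶠ i in atTop, 1 - ε / 2 < ‖α i‖ :=
    hlim.eventually (lt_mem_nhds (by linarith))
  obtain ⟨N, hN⟩ := eventually_atTop.1 hev
  obtain ⟨L, hL⟩ : ∃ L : ℕ, ∀ a, |l a| ≤ L := by
    refine ⟨∑ a, (l a).natAbs, fun a => ?_⟩
    have : (l a).natAbs ≤ ∑ a, (l a).natAbs :=
      Finset.single_le_sum (f := fun a => (l a).natAbs) (fun _ _ => Nat.zero_le _) (Finset.mem_univ a)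
    rw [Int.abs_eq_natAbs]
    exact_mod_cast this
  refine ⟨N + 4 * L, fun k => ?_⟩
  rw [← Finset.card_filter_add_card_filter_not (s := Wset (n := n) wt k) (fun d => ∃ i, d i < N + 4 * L),
    add_comm]
  refine Nat.add_le_add_right ?_ _
  have hfin : (Atilde l α ε (k : ℤ)).Finite := by
    obtain ⟨F, hsub⟩ := upper_sub l α ε hε1 k
    exact ((Finset.finite_toSet _).image F).subset hsub
  rw [← Set.ncard_coe_finset]
  refine Set.ncard_le_ncard_of_injOn (fun d : Fin n → ℕ => cls (fun a => (psum d a : ℤ) + l a)) ?_ ?_ hfin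
  · intro d hd
    simp only [Finset.coe_filter, Set.mem_ofPred_eq, not_exists, not_lt, mem_Wset _ wt_pos] at hd
    obtain ⟨hk, hd⟩ := hd
    have hx : ∀ a, (N : ℤ) + 4 * L ≤ psum d a := fun a => by
      have := hd a; have := le_psum d a; omega
    have hnn : ∀ a, (((psum d a : ℤ) + l a).toNat : ℤ) = psum d a + l a := by
      intro a
      have h1 := abs_le.1 (hL a); have := hx a; omega
    refine ⟨fun a => ((psum d a : ℤ) + l a).toNat, ?_, ?_, ?_, ?_⟩
    · simp only [hnn]
    · simp only [hnn]
      rw [Finset.sum_add_distrib, ← hk, ← sum_psum]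
      push_cast
      rfl
    · refine Rset_card l L hL _ ?_ ?_
      · intro a
        have h1 := abs_le.1 (hL a); have := hx a
        rw [hnn]; omega
      · intro a b hab
        have h1 := abs_le.1 (hL a); have h2 := abs_le.1 (hL b)
        have h3 := psum_lt d hab
        have h4 := hd b
        rw [hnn, hnn]; omega
    · intro m π
      refine lt_of_lt_of_le (by linarith : 1 - ε < 1 - ε / 2) ?_
      refine Gamma_large α _ _ N _ (by linarith) (fun i hi => (hN i hi).le) ?_
      rw [hnn, abs_neg]
      have h1 := abs_le.1 (hL m); have := hx m; have := hL (π m); omega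
  · intro d hd d' hd' h
    have hm : ∀ d ∈ ((Finset.filter (fun d => ¬ ∃ i, d i < N + 4 * L) (Wset (n := n) wt k) : Finset _) : Set (Fin n → ℕ)),
        Monotone (fun a => (psum d a : ℤ) + l a) := by
      intro d hd a b hab
      simp only [Finset.coe_filter, Set.mem_ofPred_eq, not_exists, not_lt] at hd
      rcases hab.lt_or_eq with hab | rfl
      · have h1 := abs_le.1 (hL a); have h2 := abs_le.1 (hL b)
        have h3 := psum_lt d hab
        have h4 := hd.2 b
        simp only; omega
      · exact le_rfl
    have := cls_mono_inj (hm d hd) (hm d' hd') h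
    apply psum_inj
    funext a
    have := congrFun this a
    omega

/-- If the weight `α` is regular with limit `1`, `l₁,…,lₙ` are not all equal and
`0 < ε < 1`, then `lim_{k→∞} (#Ã_{k+S_𝔩,𝓜,ε}) / P(k,n) = 1`. -/
theorem statement10 {n : ℕ} (hn : 2 ≤ n) (l : Fin n → ℤ)
    (hl : ¬ ∀ a b : Fin n, l a = l b) (α : ℕ → ℂ)
    (hlim : Tendsto (fun i => ‖α i‖) atTop (nhds 1))
    (hbd : ∀ m : ℕ, ‖α m‖ ≤ 1)
    (ε : ℝ) (hε0 : 0 < ε) (hε1 : ε < 1) :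
    Tendsto (fun k : ℕ => (Set.ncard (Atilde l α ε (k : ℤ)) : ℝ) / (P k n : ℝ))
      atTop (nhds 1) := by
  obtain ⟨C, hC⟩ := lower l α hlim ε hε0 hε1
  have hPpos : ∀ k, 0 < P k n := by
    intro k
    rw [P_eq, Finset.card_pos]
    have hlast : n - 1 < n := by omega
    refine ⟨Pi.single ⟨n - 1, hlast⟩ k, ?_⟩
    rw [mem_Wset _ wt_pos, Finset.sum_eq_single ⟨n - 1, hlast⟩]
    · have : wt (⟨n - 1, hlast⟩ : Fin n) = 1 := by simp only [wt]; omega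
      simp [this]
    · intro b _ hb
      simp [hb]
    · simp
  rw [Metric.tendsto_atTop]
  intro δ hδ
  obtain ⟨T, hT⟩ := exists_nat_gt (((n * (n * C) : ℕ) : ℝ) / δ)
  have hT0 : (0 : ℝ) < T := lt_of_le_of_lt (by positivity) hT
  obtain ⟨K, hK⟩ := bad_bound (n := n) (by omega) wt wt_pos C T (by exact_mod_cast hT0)
  refine ⟨K, fun k hk => ?_⟩
  have h1 := hK k hk
  have h2 := hC k
  have h3 := upper l α ε hε1 k
  have hp := hPpos k
  rw [← P_eq] at h1 h2 h3
  set B := ((Wset (n := n) wt k).filter fun d => ∃ i, d i < C).card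
  set A := Set.ncard (Atilde l α ε (k : ℤ))
  have hp' : (0 : ℝ) < P k n := by exact_mod_cast hp
  have h1' : (B : ℝ) * T ≤ P k n * ((n * (n * C) : ℕ) : ℝ) := by exact_mod_cast h1
  have h2' : (P k n : ℝ) ≤ A + B := by exact_mod_cast h2
  have h3' : (A : ℝ) ≤ P k n := by exact_mod_cast h3
  rw [div_lt_iff₀ hδ] at hT
  have h4 : (B : ℝ) < δ * P k n := by
    have : (B : ℝ) * T < (δ * P k n) * T := by nlinarith
    exact lt_of_mul_lt_mul_right this hT0.le
  rw [Real.dist_eq, abs_lt]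
  constructor
  · have : 1 - δ < (A : ℝ) / P k n := by
      rw [lt_div_iff₀ hp']; linarith
    linarith
  · have : (A : ℝ) / P k n ≤ 1 := by
      rw [div_le_one hp']; exact h3'
    linarith
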